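/- Adaptive Minimum Stable Expectation coverage (Proposition: AdaMinSE). Let 0 < α' ≤ α < 1, K ≥ 1, and let A_1, …, A_K be events on a probability space (Ω, ℱ, ℙ) with ℙ(A_i) ≤ α' for every i. Let p : Ω → Δ^{K−1} be measurable and suppose there exist b ∈ Δ^{K−1} and η, τ ≥ 0 with e^η·α' + τ ≤ α such that for every ω ∈ Ω and every subset G ⊆ {1,…,K}, Σ_{i∈G} p_i(ω) ≤ e^η Σ_{i∈G} b_i + τ. Then E[Σ_{i=1}^K p_i·1_{A_i}] ≤ α. -/

import Mathlib

open MeasureTheory Real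

/-- A stability bound over all subsets, evaluated on the subset of events that occur. -/
lemma sum_mul_indicator_le_of_forall_sum_le {Ω ι : Type*} [Fintype ι] (A : ι → Set Ω)
    (q b : ι → ℝ) (c τ : ℝ) (h : ∀ G : Finset ι, ∑ i ∈ G, q i ≤ c * ∑ i ∈ G, b i + τ) (ω : Ω) :
    ∑ i, q i * (A i).indicator (fun _ => (1 : ℝ)) ω ≤
      c * ∑ i, b i * (A i).indicator (fun _ => (1 : ℝ)) ω + τ := by
  classical
  simpa [Finset.sum_filter, Set.indicator_apply] using h {i | ω ∈ A i}

/-- A convex combination of probabilities that are at most `a` is at most `a`. -/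
lemma integral_sum_mul_indicator_le {Ω ι : Type*} [MeasurableSpace Ω] [Fintype ι]
    (P : Measure Ω) [IsFiniteMeasure P] (A : ι → Set Ω) (hA : ∀ i, MeasurableSet (A i))
    {a : ℝ} (hPA : ∀ i, P.real (A i) ≤ a) {b : ι → ℝ} (hb : b ∈ stdSimplex ℝ ι) :
    ∫ ω, ∑ i, b i * (A i).indicator (fun _ => (1 : ℝ)) ω ∂P ≤ a := by
  rw [integral_finsetSum _ fun i _ => ((integrable_const 1).indicator (hA i)).const_mul _]
  calc ∑ i, ∫ ω, b i * (A i).indicator (fun _ => (1 : ℝ)) ω ∂P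
      = ∑ i, b i * P.real (A i) := by
        simp [integral_const_mul, integral_indicator_const, hA]
    _ ≤ ∑ i, b i * a := by gcongr with i; exacts [hb.1 i, hPA i]
    _ = a := by rw [← Finset.sum_mul, hb.2, one_mul]

/-- **Adaptive Minimum Stable Expectation coverage (AdaMinSE).** If each miscoverage event
`A i` has probability at most `α'`, the conditional selection distribution `p ω ∈ Δ^{K-1}`
satisfies the `(η,τ)`-stability bound with respect to a prior `b`, and moreover
`e^η·α' + τ ≤ α`, then the post-selection miscoverage `E[∑ i, p i · 1_{A i}]` is at
most `α`. -/
theorem adaminse_coverage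
    {Ω : Type*} [MeasurableSpace Ω] (P : Measure Ω) [IsProbabilityMeasure P]
    (K : ℕ) (hK : 1 ≤ K) (α α' η τ : ℝ)
    (hα' : 0 < α') (hα'α : α' ≤ α) (hα : α < 1) (hη : 0 ≤ η) (hτ : 0 ≤ τ)
    (A : Fin K → Set Ω) (hAmeas : ∀ i, MeasurableSet (A i))
    (hA : ∀ i, P (A i) ≤ ENNReal.ofReal α')
    (p : Ω → Fin K → ℝ) (hp : Measurable p)
    (hpsimplex : ∀ ω, p ω ∈ stdSimplex ℝ (Fin K))
    (b : Fin K → ℝ) (hb : b ∈ stdSimplex ℝ (Fin K))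
    (hbudget : exp η * α' + τ ≤ α)
    (hstab : ∀ ω, ∀ G : Finset (Fin K), ∑ i ∈ G, p ω i ≤ exp η * ∑ i ∈ G, b i + τ) :
    ∫ ω, (∑ i, p ω i * (A i).indicator (fun _ => (1:ℝ)) ω) ∂P ≤ α := by
  have hPA : ∀ i, P.real (A i) ≤ α' := fun i => ENNReal.toReal_le_of_le_ofReal hα'.le (hA i)
  have hint : Integrable
      (fun ω => exp η * ∑ i, b i * (A i).indicator (fun _ => (1 : ℝ)) ω) P :=
    (integrable_finsetSum _ fun i _ =>
      ((integrable_const 1).indicator (hAmeas i)).const_mul _).const_mul _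
  calc ∫ ω, (∑ i, p ω i * (A i).indicator (fun _ => (1:ℝ)) ω) ∂P
      ≤ ∫ ω, (exp η * ∑ i, b i * (A i).indicator (fun _ => (1 : ℝ)) ω + τ) ∂P := by
        refine integral_mono_of_nonneg (.of_forall fun ω => ?_)
          (hint.add (integrable_const τ)) (.of_forall fun ω => ?_)
        · exact Finset.sum_nonneg fun i _ => mul_nonneg ((hpsimplex ω).1 i)
            (Set.indicator_nonneg (fun _ _ => zero_le_one) ω)
        · exact sum_mul_indicator_le_of_forall_sum_le A (p ω) b _ τ (hstab ω) ω
    _ = exp η * ∫ ω, ∑ i, b i * (A i).indicator (fun _ => (1 : ℝ)) ω ∂P + τ := by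
        rw [integral_add hint (integrable_const τ), integral_const_mul]
        simp
    _ ≤ exp η * α' + τ := by
        gcongr
        exact integral_sum_mul_indicator_le P A hAmeas hPA hb
    _ ≤ α := hbudget
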